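/- Suppose $p=r=1$, $q,s\in L^1_{loc}$, $\tau$ regular at $a$, and let $\phi_z$ be a real entire solution of $(\tau-z)u=0$ lying in $\mathrm{dom}(S)$ near $a$. Then for every $x_0,x\in(a,b)$, $\phi_z(x) = \phi_z(x_0)\,e^{(x-x_0)\sqrt{-z}}\,(1+o(1))$ as $|z|\to\infty$ along any nonreal ray. -/

import Mathlib

open MeasureTheory Set Filter Complex Topology ComplexConjugate

noncomputable section

/-- `f` is locally absolutely continuous on `(a,b)` with a.e. derivative `g`,
encoded via the integral representation. -/
def HasACDeriv (a b : ℝ) (f g : ℝ → ℂ) : Prop :=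
  ∀ x ∈ Set.Ioo a b, ∀ y ∈ Set.Ioo a b,
    IntervalIntegrable g volume y x ∧ f x = f y + ∫ t in y..x, g t

/-- `f` lies in the domain `𝔇_τ` with first quasi-derivative `fq = p (f' + s f)` and
`τ f = w`, encoded via the equivalent first order system
`(f, f^{[1]})' = ((-s, 1/p), (q - 0·r, s)) (f, f^{[1]}) - (0, r·w)`. -/
structure SLSys (a b : ℝ) (p q r s : ℝ → ℝ) (f fq w : ℝ → ℂ) : Prop where
  fst : HasACDeriv a b f fun x => fq x / (p x : ℂ) - (s x : ℂ) * f x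
  snd : HasACDeriv a b fq fun x => (s x : ℂ) * fq x + (q x : ℂ) * f x - (r x : ℂ) * w x

/-- Standing hypothesis on the coefficients `p, q, r, s` on `(a,b)`:
real-valued and measurable, `p⁻¹, q, r, s ∈ L¹_loc((a,b))`, `p ≠ 0` and `r > 0` a.e. -/
structure SLHyp (a b : ℝ) (p q r s : ℝ → ℝ) : Prop where
  lt : a < b
  mp : Measurable p
  mq : Measurable q
  mr : Measurable r
  ms : Measurable s
  ip : ∀ x ∈ Set.Ioo a b, ∀ y ∈ Set.Ioo a b,
    IntervalIntegrable (fun t => (p t)⁻¹) volume y x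
  iq : ∀ x ∈ Set.Ioo a b, ∀ y ∈ Set.Ioo a b, IntervalIntegrable q volume y x
  ir : ∀ x ∈ Set.Ioo a b, ∀ y ∈ Set.Ioo a b, IntervalIntegrable r volume y x
  is' : ∀ x ∈ Set.Ioo a b, ∀ y ∈ Set.Ioo a b, IntervalIntegrable s volume y x
  pne : ∀ᵐ t ∂(volume.restrict (Set.Ioo a b)), p t ≠ 0
  rpos : ∀ᵐ t ∂(volume.restrict (Set.Ioo a b)), 0 < r t

/-- The modified Wronskian `W(f,g)(x) = f(x) g^{[1]}(x) - f^{[1]}(x) g(x)`. -/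
def Wr (f fq g gq : ℝ → ℂ) (x : ℝ) : ℂ := f x * gq x - fq x * g x

/-- The branch `√(-z) = (-z)^{1/2}` of the square root with positive real part. -/
def msqrt (z : ℂ) : ℂ := (-z) ^ (1 / 2 : ℂ)

/-- A non-trivial real entire solution family `φ_z` of `(τ - z) u = 0` (`p = r = 1`)
lying in the domain of a self-adjoint realization `S` near `a`: square integrable
near `a` and satisfying the boundary condition at `a`, the latter encoded via the
vanishing of the Wronskians of members of the family at `a`. -/
structure RealEntireSolFamSchr (a b : ℝ) (q s : ℝ → ℝ) (φ φq : ℂ → ℝ → ℂ) : Prop where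
  sol : ∀ z : ℂ, SLSys a b (fun _ => 1) q (fun _ => 1) s (φ z) (φq z) fun x => z * φ z x
  entire : ∀ x ∈ Set.Ioo a b,
    (Differentiable ℂ fun z => φ z x) ∧ Differentiable ℂ fun z => φq z x
  real : ∀ z : ℂ, ∀ x ∈ Set.Ioo a b,
    φ (conj z) x = conj (φ z x) ∧ φq (conj z) x = conj (φq z x)
  nontriv : ∀ z : ℂ, ∃ x ∈ Set.Ioo a b, φ z x ≠ 0 ∨ φq z x ≠ 0
  sqint : ∀ z : ℂ, ∀ c ∈ Set.Ioo a b, IntegrableOn (fun x => ‖φ z x‖ ^ 2) (Set.Ioo a c)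
  bc : ∀ z ζ : ℂ, Tendsto (Wr (φ z) (φq z) (φ ζ) (φq ζ)) (𝓝[>] a) (𝓝 0)

lemma gronwall_step {f κ : ℝ → ℝ} {C : ℝ} {a b : ℝ} (hab : a ≤ b)
    (hf : ContinuousOn f (Icc a b)) (hf0 : ∀ x ∈ Icc a b, 0 ≤ f x)
    (hκ : IntervalIntegrable κ volume a b) (hκ0 : ∀ x, 0 ≤ κ x)
    (h : ∀ x ∈ Icc a b, f x ≤ C + ∫ t in a..x, κ t * f t)
    (hK : ∫ t in a..b, κ t ≤ 1 / 2) : ∀ x ∈ Icc a b, f x ≤ 2 * C := by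
  obtain ⟨m, hm, hmax⟩ := isCompact_Icc.exists_isMaxOn (nonempty_Icc.mpr hab) hf
  have hmax' : ∀ x ∈ Icc a b, f x ≤ f m := fun x hx => hmax hx
  have hsub : Icc a m ⊆ Icc a b := Icc_subset_Icc le_rfl hm.2
  have hκm : IntervalIntegrable κ volume a m :=
    hκ.mono_set (by rw [uIcc_of_le hm.1, uIcc_of_le hab]; exact hsub)
  have h1 : ∫ t in a..m, κ t * f t ≤ ∫ t in a..m, κ t * f m := by
    apply intervalIntegral.integral_mono_on hm.1
    · exact hκm.mul_continuousOn (by rw [uIcc_of_le hm.1]; exact hf.mono hsub)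
    · exact hκm.mul_const _
    · intro x hx
      exact mul_le_mul_of_nonneg_left (hmax' x (hsub hx)) (hκ0 x)
  have h2 : ∫ t in a..m, κ t ≤ ∫ t in a..b, κ t := by
    apply intervalIntegral.integral_mono_interval le_rfl hm.1 hm.2 _ hκ
    exact Eventually.of_forall hκ0
  rw [intervalIntegral.integral_mul_const] at h1
  have h3 := h m hm
  have h4 := hf0 m hm
  have h5 : (∫ t in a..m, κ t) * f m ≤ 1 / 2 * f m :=
    mul_le_mul_of_nonneg_right (h2.trans hK) h4
  intro x hx
  have := hmax' x hx
  linarith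

lemma gronwall_aux {f κ : ℝ → ℝ} {b : ℝ} (hκ0 : ∀ x, 0 ≤ κ x) (n : ℕ) :
    ∀ (a C : ℝ), a ≤ b → 0 ≤ C →
    ContinuousOn f (Icc a b) → (∀ x ∈ Icc a b, 0 ≤ f x) →
    IntervalIntegrable κ volume a b →
    (∀ x ∈ Icc a b, f x ≤ C + ∫ t in a..x, κ t * f t) →
    ∫ t in a..b, κ t ≤ (n + 1 : ℝ) / 2 → ∀ x ∈ Icc a b, f x ≤ 2 ^ (n + 1) * C := by
  induction n with
  | zero =>
    intro a C hab hC hf hf0 hκ h hK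
    simpa using gronwall_step hab hf hf0 hκ hκ0 h (by simpa using hK)
  | succ n ih =>
    intro a C hab hC hf hf0 hκ h hK
    have h2n : (1 : ℝ) ≤ 2 ^ (n + 1) := one_le_pow₀ (by norm_num)
    have hbig : 2 * C ≤ 2 ^ (n + 1 + 1) * C := by
      rw [pow_succ]; nlinarith
    by_cases hs : ∫ t in a..b, κ t ≤ 1 / 2
    · intro x hx
      exact (gronwall_step hab hf hf0 hκ hκ0 h hs x hx).trans hbig
    push Not at hs
    have hcont : ContinuousOn (fun x => ∫ t in a..x, κ t) (Icc a b) := by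
      have := intervalIntegral.continuousOn_primitive_interval' hκ left_mem_uIcc
      rwa [uIcc_of_le hab] at this
    obtain ⟨c, hc, hc2⟩ : (1 / 2 : ℝ) ∈ (fun x => ∫ t in a..x, κ t) '' Icc a b := by
      apply intermediate_value_Icc hab hcont
      exact ⟨by simp, hs.le⟩
    have hc2 : ∫ t in a..c, κ t = 1 / 2 := hc2
    have hs1 : Icc a c ⊆ Icc a b := Icc_subset_Icc le_rfl hc.2
    have hs2 : Icc c b ⊆ Icc a b := Icc_subset_Icc hc.1 le_rfl
    have hκ1 : IntervalIntegrable κ volume a c :=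
      hκ.mono_set (by rw [uIcc_of_le hc.1, uIcc_of_le hab]; exact hs1)
    have hκ2 : IntervalIntegrable κ volume c b :=
      hκ.mono_set (by rw [uIcc_of_le hc.2, uIcc_of_le hab]; exact hs2)
    have hkf : IntervalIntegrable (fun t => κ t * f t) volume a b :=
      hκ.mul_continuousOn (by rw [uIcc_of_le hab]; exact hf)
    have hstep := gronwall_step hc.1 (hf.mono hs1) (fun x hx => hf0 x (hs1 hx)) hκ1 hκ0
      (fun x hx => h x (hs1 hx)) hc2.le
    have hI : ∫ t in a..c, κ t * f t ≤ C := by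
      have : ∫ t in a..c, κ t * f t ≤ ∫ t in a..c, κ t * (2 * C) := by
        apply intervalIntegral.integral_mono_on hc.1
        · exact hκ1.mul_continuousOn (by rw [uIcc_of_le hc.1]; exact hf.mono hs1)
        · exact hκ1.mul_const _
        · intro x hx
          exact mul_le_mul_of_nonneg_left (hstep x hx) (hκ0 x)
      rw [intervalIntegral.integral_mul_const, hc2] at this
      linarith
    have hadd := intervalIntegral.integral_add_adjacent_intervals hκ1 hκ2
    have hrec := ih c (2 * C) hc.2 (by linarith) (hf.mono hs2) (fun x hx => hf0 x (hs2 hx)) hκ2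
      (by
        intro x hx
        have h3 := h x (hs2 hx)
        have h4 : ∫ t in a..x, κ t * f t = (∫ t in a..c, κ t * f t) + ∫ t in c..x, κ t * f t := by
          symm
          apply intervalIntegral.integral_add_adjacent_intervals
          · exact hkf.mono_set (by rw [uIcc_of_le hc.1, uIcc_of_le hab]; exact hs1)
          · exact hkf.mono_set (by
              rw [uIcc_of_le hx.1, uIcc_of_le hab]; exact Icc_subset_Icc hc.1 hx.2)
        linarith)
      (by push_cast at hK; linarith)
    intro x hx
    rcases le_total x c with hxc | hxc
    · exact (hstep x ⟨hx.1, hxc⟩).trans hbig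
    · have := hrec x ⟨hxc, hx.2⟩
      calc f x ≤ _ := this
        _ = _ := by ring

/-- Gronwall with an `L¹` kernel. -/
lemma gronwall_fwd {κ : ℝ → ℝ} {a b : ℝ} (hab : a ≤ b) (hκ0 : ∀ x, 0 ≤ κ x)
    (hκ : IntervalIntegrable κ volume a b) :
    ∃ M : ℝ, 0 < M ∧ ∀ (f : ℝ → ℝ) (C c : ℝ), 0 ≤ C → c ∈ Icc a b →
      ContinuousOn f (Icc a c) → (∀ x ∈ Icc a c, 0 ≤ f x) →
      (∀ x ∈ Icc a c, f x ≤ C + ∫ t in a..x, κ t * f t) →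
      ∀ x ∈ Icc a c, f x ≤ M * C := by
  obtain ⟨n, hn⟩ := exists_nat_ge (2 * ∫ t in a..b, κ t)
  refine ⟨2 ^ (n + 1), by positivity, ?_⟩
  intro f C c hC hc hf hf0 h
  have h2 : ∫ t in a..c, κ t ≤ ∫ t in a..b, κ t := by
    apply intervalIntegral.integral_mono_interval le_rfl hc.1 hc.2 _ hκ
    exact Eventually.of_forall hκ0
  exact gronwall_aux hκ0 n a C hc.1 hC hf hf0
    (hκ.mono_set (by
      rw [uIcc_of_le hc.1, uIcc_of_le hab]; exact Icc_subset_Icc le_rfl hc.2)) h (by linarith)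

lemma gronwall_bwd {κ : ℝ → ℝ} {a b : ℝ} (hab : a ≤ b) (hκ0 : ∀ x, 0 ≤ κ x)
    (hκ : IntervalIntegrable κ volume a b) :
    ∃ M : ℝ, 0 < M ∧ ∀ (f : ℝ → ℝ) (C c : ℝ), 0 ≤ C → c ∈ Icc a b →
      ContinuousOn f (Icc c b) → (∀ x ∈ Icc c b, 0 ≤ f x) →
      (∀ x ∈ Icc c b, f x ≤ C + ∫ t in x..b, κ t * f t) →
      ∀ x ∈ Icc c b, f x ≤ M * C := by
  have hκ' : IntervalIntegrable (fun t => κ (-t)) volume (-b) (-a) := by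
    have := (IntervalIntegrable.iff_comp_neg).mp hκ
    exact this.symm
  obtain ⟨M, hM, H⟩ := gronwall_fwd (neg_le_neg hab) (fun x => hκ0 (-x)) hκ'
  refine ⟨M, hM, ?_⟩
  intro f C c hC hc hf hf0 h x hx
  have := H (fun t => f (-t)) C (-c) hC ⟨by linarith [hc.2], by linarith [hc.1]⟩
    (hf.comp continuous_neg.continuousOn
      (fun y hy => ⟨by linarith [hy.2], by linarith [hy.1]⟩))
    (fun y hy => hf0 _ ⟨by linarith [hy.2], by linarith [hy.1]⟩)
    (fun y hy => by
      have h1 := h (-y) ⟨by linarith [hy.2], by linarith [hy.1]⟩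
      have h2 : ∫ t in (-b)..y, κ (-t) * f (-t) = ∫ t in (-y)..b, κ t * f t := by
        have := intervalIntegral.integral_comp_neg (a := -b) (b := y) (fun t => κ t * f t)
        simpa using this
      simpa [h2] using h1)
    (-x) ⟨by linarith [hx.2], by linarith [hx.1]⟩
  simpa using this

lemma ac_prim {g : ℝ → ℂ} {a b : ℝ} (hg : IntervalIntegrable g volume a b) :
    AbsolutelyContinuousOnInterval (fun x => ∫ t in a..x, g t) a b := by
  have hre : IntervalIntegrable (fun t => (g t).re) volume a b :=
    ⟨hg.1.re, hg.2.re⟩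
  have him : IntervalIntegrable (fun t => (g t).im) volume a b :=
    ⟨hg.1.im, hg.2.im⟩
  have h1 := hre.absolutelyContinuousOnInterval_intervalIntegral left_mem_uIcc
  have h2 := him.absolutelyContinuousOnInterval_intervalIntegral left_mem_uIcc
  have c1 : AbsolutelyContinuousOnInterval (fun _ : ℝ => (1 : ℂ)) a b :=
    (contDiff_const.contDiffOn).absolutelyContinuousOnInterval
  have c2 : AbsolutelyContinuousOnInterval (fun _ : ℝ => Complex.I) a b :=
    (contDiff_const.contDiffOn).absolutelyContinuousOnInterval
  have h3 := (h1.smul c1).add (h2.smul c2)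
  -- equality on the interval is enough
  rw [absolutelyContinuousOnInterval_iff] at h3 ⊢
  intro ε hε
  obtain ⟨δ, hδ, H⟩ := h3 ε hε
  refine ⟨δ, hδ, fun E hE hE2 => ?_⟩
  have := H E hE hE2
  refine lt_of_eq_of_lt ?_ this
  refine Finset.sum_congr rfl fun i hi => ?_
  have key : ∀ x ∈ uIcc a b, (∫ t in a..x, g t) =
      ((fun x => ∫ v in a..x, (g v).re) • (fun _ : ℝ => (1 : ℂ)) +
        (fun x => ∫ v in a..x, (g v).im) • fun _ : ℝ => Complex.I) x := by
    intro x hx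
    have hgx : IntervalIntegrable g volume a x :=
      hg.mono_set (uIcc_subset_uIcc left_mem_uIcc hx)
    simp only [Pi.add_apply, Pi.smul_apply', Complex.real_smul, mul_one]
    have e1 : ∫ v in a..x, (g v).re = (∫ v in a..x, g v).re := by
      exact Complex.reCLM.intervalIntegral_comp_comm hgx
    have e2 : ∫ v in a..x, (g v).im = (∫ v in a..x, g v).im := by
      exact Complex.imCLM.intervalIntegral_comp_comm hgx
    rw [e1, e2, Complex.re_add_im]
  rw [key _ (hE.1 i hi).1, key _ (hE.1 i hi).2]

lemma prod_int {f g : ℝ → ℂ} {a b : ℝ} (hab : a ≤ b) (hg : IntervalIntegrable g volume a b)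
    (hf : ∀ x ∈ Icc a b, f x = f a + ∫ t in a..x, g t) (N l : ℂ) :
    N * Complex.exp (l * ((b : ℂ) - a)) * f b =
      N * f a + ∫ t in a..b, N * Complex.exp (l * ((t : ℂ) - a)) * (l * f t + g t) := by
  set E : ℝ → ℂ := fun t => N * Complex.exp (l * ((t : ℂ) - a)) with hE
  have hEd : ∀ t, HasDerivAt E (l * E t) t := by
    intro t
    have h1 : HasDerivAt (fun t : ℝ => l * ((t : ℂ) - a)) (l * 1) t :=
      ((Complex.ofRealCLM.hasDerivAt (x := t)).sub_const _).const_mul l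
    have := (h1.cexp).const_mul N
    refine this.congr_deriv ?_
    change _ = l * (N * Complex.exp (l * ((t : ℂ) - a)))
    ring
  have hEc : Continuous E := continuous_iff_continuousAt.mpr fun t => (hEd t).continuousAt
  have hEac : AbsolutelyContinuousOnInterval E a b := by
    apply ContDiffOn.absolutelyContinuousOnInterval
    apply ContDiff.contDiffOn
    rw [contDiff_one_iff_deriv]
    refine ⟨fun t => (hEd t).differentiableAt, ?_⟩
    have : deriv E = fun t => l * E t := funext fun t => (hEd t).deriv
    rw [this]; exact continuous_const.mul hEc
  set F : ℝ → ℂ := fun x => f a + ∫ t in a..x, g t with hF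
  have hFac : AbsolutelyContinuousOnInterval F a b := by
    have c1 : AbsolutelyContinuousOnInterval (fun _ : ℝ => f a) a b :=
      (contDiff_const.contDiffOn).absolutelyContinuousOnInterval
    exact c1.add (ac_prim hg)
  have hFc : ContinuousOn F (uIcc a b) := hFac.continuousOn
  have hG : IntervalIntegrable (fun t => E t * (l * F t + g t)) volume a b := by
    apply IntervalIntegrable.continuousOn_mul _ hEc.continuousOn
    exact ((hFc.const_smul l).intervalIntegrable).add hg
  have hac := (hEac.smul hFac).sub (ac_prim hG)
  obtain ⟨C, hC⟩ := hac.const_of_ae_hasDerivAt_zero (by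
    filter_upwards [hg.ae_hasDerivAt_integral, hG.ae_hasDerivAt_integral] with x h1 h2 hx
    have d1 := (h1 hx a left_mem_uIcc).const_add (f a)
    have d2 := h2 hx a left_mem_uIcc
    have d3 := ((hEd x).mul d1).sub d2
    refine HasDerivAt.congr_deriv (f := E • F - fun x => ∫ t in a..x, E t * (l * F t + g t)) d3 ?_
    change l * E x * F x + E x * g x - E x * (l * F x + g x) = 0
    ring)
  have e1 := hC a left_mem_uIcc
  have e2 := hC b right_mem_uIcc
  simp only [Pi.sub_apply, smul_eq_mul, Pi.mul_apply, intervalIntegral.integral_same] at e1 e2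
  have hcong : ∫ t in a..b, E t * (l * F t + g t) = ∫ t in a..b, E t * (l * f t + g t) := by
    apply intervalIntegral.integral_congr
    intro t ht
    rw [uIcc_of_le hab] at ht
    simp only [hF]
    rw [← hf t ht]
  have e3 : F b = f b := (hf b ⟨hab, le_rfl⟩).symm
  have e4 : F a = f a := by simp [hF]
  have e5 : E a = N := by simp [hE]
  rw [e3, hcong] at e2
  rw [e4, e5] at e1
  change E b * f b = N * f a + ∫ t in a..b, E t * (l * f t + g t)
  linear_combination e2 - e1

/-- Solution of the first order system up to the regular endpoint `a`. -/
structure SolA (a b : ℝ) (q s : ℝ → ℝ) (z : ℂ) (u v : ℝ → ℂ) : Prop where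
  int1 : ∀ x ∈ Ico a b, IntervalIntegrable (fun t => v t - (s t : ℂ) * u t) volume a x
  eq1 : ∀ x ∈ Ico a b, u x = u a + ∫ t in a..x, (v t - (s t : ℂ) * u t)
  int2 : ∀ x ∈ Ico a b,
    IntervalIntegrable (fun t => (s t : ℂ) * v t + (q t : ℂ) * u t - z * u t) volume a x
  eq2 : ∀ x ∈ Ico a b, v x = v a + ∫ t in a..x, ((s t : ℂ) * v t + (q t : ℂ) * u t - z * u t)

lemma acderiv_continuousOn {a b : ℝ} {f g : ℝ → ℂ} (h : HasACDeriv a b f g) {c d : ℝ}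
    (hc : c ∈ Ioo a b) (hd : d ∈ Ioo a b) (hcd : c ≤ d) : ContinuousOn f (Icc c d) := by
  have h1 := (h d hd c hc).1
  have h2 := intervalIntegral.continuousOn_primitive_interval' h1 left_mem_uIcc
  rw [uIcc_of_le hcd] at h2
  have h3 := (continuousOn_const (c := f c)).add h2
  refine h3.congr fun x hx => ?_
  exact (h x ⟨hc.1.trans_le hx.1, hx.2.trans_lt hd.2⟩ c hc).2

lemma acderiv_continuousOn_Ioo {a b : ℝ} {f g : ℝ → ℂ} (h : HasACDeriv a b f g) :
    ContinuousOn f (Ioo a b) := by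
  intro x hx
  obtain ⟨c, hc1, hc2⟩ := exists_between hx.1
  obtain ⟨d, hd1, hd2⟩ := exists_between hx.2
  have := acderiv_continuousOn h (c := c) (d := d) ⟨hc1, by linarith⟩ ⟨by linarith, hd2⟩
    (by linarith)
  exact (this.continuousAt (Icc_mem_nhds hc2 hd1)).continuousWithinAt

lemma deriv_bound (sx qx : ℝ) (z U V : ℂ) :
    ‖V - (sx : ℂ) * U‖ + ‖(sx : ℂ) * V + (qx : ℂ) * U - z * U‖ ≤
      (1 + ‖z‖ + |sx| + |qx|) * (‖U‖ + ‖V‖) := by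
  have h1 : ‖V - (sx : ℂ) * U‖ ≤ ‖V‖ + |sx| * ‖U‖ := by
    refine (norm_sub_le _ _).trans ?_
    simp
  have h2 : ‖(sx : ℂ) * V + (qx : ℂ) * U - z * U‖ ≤ |sx| * ‖V‖ + |qx| * ‖U‖ + ‖z‖ * ‖U‖ := by
    refine (norm_sub_le _ _).trans ?_
    have := norm_add_le ((sx : ℂ) * V) ((qx : ℂ) * U)
    simp at this ⊢
    linarith
  have := norm_nonneg U
  have := norm_nonneg V
  have := norm_nonneg z
  have := abs_nonneg sx
  have := abs_nonneg qx
  have e1 : 0 ≤ ‖z‖ * ‖V‖ := by positivity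
  have e2 : 0 ≤ |qx| * ‖V‖ := by positivity
  nlinarith

lemma exists_ext {a b : ℝ} {q s : ℝ → ℝ} (hab : a < b) (hms : Measurable s) (hmq : Measurable q)
    (hq : ∀ x ∈ Set.Ioo a b, IntervalIntegrable q volume a x)
    (hs : ∀ x ∈ Set.Ioo a b, IntervalIntegrable s volume a x)
    {f fq : ℝ → ℂ} {z : ℂ}
    (h : SLSys a b (fun _ => 1) q (fun _ => 1) s f fq fun x => z * f x) :
    ∃ u v : ℝ → ℂ, (∀ x ∈ Ioo a b, u x = f x ∧ v x = fq x) ∧ SolA a b q s z u v := by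
  obtain ⟨hf1, hf2⟩ := h
  set g1 : ℝ → ℂ := fun t => fq t - (s t : ℂ) * f t with hg1
  set g2 : ℝ → ℂ := fun t => (s t : ℂ) * fq t + (q t : ℂ) * f t - z * f t with hg2
  have hf1 : HasACDeriv a b f g1 := by simpa [hg1] using hf1
  have hf2 : HasACDeriv a b fq g2 := by simpa [hg2] using hf2
  obtain ⟨c, hc⟩ := exists_between hab
  have hc : c ∈ Ioo a b := hc
  set κ : ℝ → ℝ := fun t => 1 + ‖z‖ + |s t| + |q t| with hκ
  have hκ0 : ∀ t, 0 ≤ κ t := fun t => by positivity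
  have hκi : IntervalIntegrable κ volume a c :=
    ((intervalIntegrable_const).add (hs c hc).abs).add (hq c hc).abs
  obtain ⟨M, hM, H⟩ := gronwall_bwd hc.1.le hκ0 hκi
  set D := M * (‖f c‖ + ‖fq c‖) with hD
  have hbd : ∀ x ∈ Ioc a c, ‖f x‖ + ‖fq x‖ ≤ D := by
    intro d hd
    have hdm : d ∈ Ioo a b := ⟨hd.1, hd.2.trans_lt hc.2⟩
    have c1 := acderiv_continuousOn hf1 hdm hc hd.2
    have c2 := acderiv_continuousOn hf2 hdm hc hd.2
    have hcont : ContinuousOn (fun x => ‖f x‖ + ‖fq x‖) (Icc d c) := c1.norm.add c2.norm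
    refine H (fun x => ‖f x‖ + ‖fq x‖) (‖f c‖ + ‖fq c‖) d (by positivity) ⟨hd.1.le, hd.2⟩ hcont
      (fun x _ => by positivity) ?_ d ⟨le_rfl, hd.2⟩
    intro x hx
    have hxm : x ∈ Ioo a b := ⟨hd.1.trans_le hx.1, hx.2.trans_lt hc.2⟩
    have i1 := hf1 x hxm c hc
    have i2 := hf2 x hxm c hc
    have n1 : ‖f x‖ ≤ ‖f c‖ + ∫ t in x..c, ‖g1 t‖ := by
      rw [i1.2, intervalIntegral.integral_symm]
      refine (norm_add_le _ _).trans ?_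
      rw [norm_neg]
      gcongr
      exact intervalIntegral.norm_integral_le_integral_norm hx.2
    have n2 : ‖fq x‖ ≤ ‖fq c‖ + ∫ t in x..c, ‖g2 t‖ := by
      rw [i2.2, intervalIntegral.integral_symm]
      refine (norm_add_le _ _).trans ?_
      rw [norm_neg]
      gcongr
      exact intervalIntegral.norm_integral_le_integral_norm hx.2
    have n3 : (∫ t in x..c, ‖g1 t‖) + ∫ t in x..c, ‖g2 t‖ ≤
        ∫ t in x..c, κ t * (‖f t‖ + ‖fq t‖) := by
      rw [← intervalIntegral.integral_add i1.1.symm.norm i2.1.symm.norm]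
      apply intervalIntegral.integral_mono_on hx.2 (i1.1.symm.norm.add i2.1.symm.norm)
      · apply IntervalIntegrable.mul_continuousOn
        · exact hκi.mono_set (by
            rw [uIcc_of_le hx.2, uIcc_of_le hc.1.le]
            exact Icc_subset_Icc hxm.1.le le_rfl)
        · rw [uIcc_of_le hx.2]
          exact hcont.mono (Icc_subset_Icc hx.1 le_rfl)
      · intro t _
        exact deriv_bound (s t) (q t) z (f t) (fq t)
    linarith
  have hsub : Ioc a c ⊆ Ioo a b := fun x hx => ⟨hx.1, hx.2.trans_lt hc.2⟩
  have mf : AEStronglyMeasurable f (volume.restrict (Ioc a c)) :=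
    ((acderiv_continuousOn_Ioo hf1).mono hsub).aestronglyMeasurable measurableSet_Ioc
  have mfq : AEStronglyMeasurable fq (volume.restrict (Ioc a c)) :=
    ((acderiv_continuousOn_Ioo hf2).mono hsub).aestronglyMeasurable measurableSet_Ioc
  have msC : AEStronglyMeasurable (fun t => (s t : ℂ)) (volume.restrict (Ioc a c)) :=
    (Complex.measurable_ofReal.comp hms).aestronglyMeasurable
  have mqC : AEStronglyMeasurable (fun t => (q t : ℂ)) (volume.restrict (Ioc a c)) :=
    (Complex.measurable_ofReal.comp hmq).aestronglyMeasurable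
  have hbig : IntegrableOn (fun t => κ t * D) (Ioc a c) volume := (hκi.mul_const D).1
  have hae : ∀ᵐ t ∂(volume.restrict (Ioc a c)), ‖g1 t‖ + ‖g2 t‖ ≤ κ t * D := by
    refine (ae_restrict_iff' measurableSet_Ioc).mpr (Eventually.of_forall fun t ht => ?_)
    exact (deriv_bound (s t) (q t) z (f t) (fq t)).trans
      (mul_le_mul_of_nonneg_left (hbd t ht) (hκ0 t))
  have ig1 : IntervalIntegrable g1 volume a c := by
    rw [intervalIntegrable_iff_integrableOn_Ioc_of_le hc.1.le]
    refine Integrable.mono' hbig (mfq.sub (msC.mul mf)) ?_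
    filter_upwards [hae] with t ht
    linarith [norm_nonneg (g2 t)]
  have ig2 : IntervalIntegrable g2 volume a c := by
    rw [intervalIntegrable_iff_integrableOn_Ioc_of_le hc.1.le]
    refine Integrable.mono' hbig (((msC.mul mfq).add (mqC.mul mf)).sub (mf.const_mul z)) ?_
    filter_upwards [hae] with t ht
    linarith [norm_nonneg (g1 t)]
  set u := Function.update f a (f c - ∫ t in a..c, g1 t) with hu
  set v := Function.update fq a (fq c - ∫ t in a..c, g2 t) with hv
  have huv : ∀ x ∈ Ioo a b, u x = f x ∧ v x = fq x := by
    intro x hx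
    simp [hu, hv, Function.update_of_ne hx.1.ne']
  have hua : u a = f c - ∫ t in a..c, g1 t := by simp [hu]
  have hva : v a = fq c - ∫ t in a..c, g2 t := by simp [hv]
  have e1 : ∀ x ∈ Ico a b, EqOn g1 (fun t => v t - (s t : ℂ) * u t) (uIoc a x) := by
    intro x hx t ht
    rw [uIoc_of_le hx.1] at ht
    obtain ⟨h1, h2⟩ := huv t ⟨ht.1, ht.2.trans_lt hx.2⟩
    simp only [hg1, h1, h2]
  have e2 : ∀ x ∈ Ico a b,
      EqOn g2 (fun t => (s t : ℂ) * v t + (q t : ℂ) * u t - z * u t) (uIoc a x) := by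
    intro x hx t ht
    rw [uIoc_of_le hx.1] at ht
    obtain ⟨h1, h2⟩ := huv t ⟨ht.1, ht.2.trans_lt hx.2⟩
    simp only [hg2, h1, h2]
  have I1 : ∀ x ∈ Ico a b, IntervalIntegrable g1 volume a x := by
    intro x hx
    rcases hx.1.eq_or_lt with rfl | hx1
    · exact IntervalIntegrable.refl
    · exact ig1.trans (hf1 x ⟨hx1, hx.2⟩ c hc).1
  have I2 : ∀ x ∈ Ico a b, IntervalIntegrable g2 volume a x := by
    intro x hx
    rcases hx.1.eq_or_lt with rfl | hx1
    · exact IntervalIntegrable.refl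
    · exact ig2.trans (hf2 x ⟨hx1, hx.2⟩ c hc).1
  refine ⟨u, v, huv, ?_, ?_, ?_, ?_⟩
  · intro x hx
    exact (I1 x hx).congr (e1 x hx)
  · intro x hx
    rw [← intervalIntegral.integral_congr_ae (Eventually.of_forall (e1 x hx))]
    rcases hx.1.eq_or_lt with rfl | hx1
    · simp
    · have hx' : x ∈ Ioo a b := ⟨hx1, hx.2⟩
      have h3 := hf1 x hx' c hc
      rw [(huv x hx').1, hua, h3.2, ← intervalIntegral.integral_add_adjacent_intervals ig1 h3.1]
      ring
  · intro x hx
    exact (I2 x hx).congr (e2 x hx)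
  · intro x hx
    rw [← intervalIntegral.integral_congr_ae (Eventually.of_forall (e2 x hx))]
    rcases hx.1.eq_or_lt with rfl | hx1
    · simp
    · have hx' : x ∈ Ioo a b := ⟨hx1, hx.2⟩
      have h3 := hf2 x hx' c hc
      rw [(huv x hx').2, hva, h3.2, ← intervalIntegral.integral_add_adjacent_intervals ig2 h3.1]
      ring

lemma SolA.cont {a b : ℝ} {q s : ℝ → ℝ} {z : ℂ} {u v : ℝ → ℂ} (h : SolA a b q s z u v)
    {X : ℝ} (hX : X ∈ Ico a b) : ContinuousOn u (Icc a X) ∧ ContinuousOn v (Icc a X) := by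
  constructor
  · have h2 := intervalIntegral.continuousOn_primitive_interval' (h.int1 X hX) left_mem_uIcc
    rw [uIcc_of_le hX.1] at h2
    refine ((continuousOn_const (c := u a)).add h2).congr fun x hx => ?_
    exact h.eq1 x ⟨hx.1, hx.2.trans_lt hX.2⟩
  · have h2 := intervalIntegral.continuousOn_primitive_interval' (h.int2 X hX) left_mem_uIcc
    rw [uIcc_of_le hX.1] at h2
    refine ((continuousOn_const (c := v a)).add h2).congr fun x hx => ?_
    exact h.eq2 x ⟨hx.1, hx.2.trans_lt hX.2⟩

lemma SolA.zero {a b : ℝ} {q s : ℝ → ℝ} {z : ℂ} {u v : ℝ → ℂ} (h : SolA a b q s z u v)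
    (hq : ∀ x ∈ Set.Ioo a b, IntervalIntegrable q volume a x)
    (hs : ∀ x ∈ Set.Ioo a b, IntervalIntegrable s volume a x)
    (hu : u a = 0) (hv : v a = 0) {X : ℝ} (hX : X ∈ Ioo a b) : u X = 0 ∧ v X = 0 := by
  have hX' : X ∈ Ico a b := ⟨hX.1.le, hX.2⟩
  set κ : ℝ → ℝ := fun t => 1 + ‖z‖ + |s t| + |q t| with hκ
  have hκ0 : ∀ t, 0 ≤ κ t := fun t => by positivity
  have hκi : IntervalIntegrable κ volume a X :=
    ((intervalIntegrable_const).add (hs X hX).abs).add (hq X hX).abs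
  obtain ⟨M, hM, H⟩ := gronwall_fwd hX.1.le hκ0 hκi
  obtain ⟨c1, c2⟩ := h.cont hX'
  have hcont : ContinuousOn (fun x => ‖u x‖ + ‖v x‖) (Icc a X) := c1.norm.add c2.norm
  have := H (fun x => ‖u x‖ + ‖v x‖) 0 X le_rfl ⟨hX.1.le, le_rfl⟩ hcont
    (fun x _ => by positivity) (by
      intro x hx
      have hxm : x ∈ Ico a b := ⟨hx.1, hx.2.trans_lt hX.2⟩
      have n1 : ‖u x‖ ≤ ∫ t in a..x, ‖v t - (s t : ℂ) * u t‖ := by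
        rw [h.eq1 x hxm, hu, zero_add]
        exact intervalIntegral.norm_integral_le_integral_norm hx.1
      have n2 : ‖v x‖ ≤ ∫ t in a..x, ‖(s t : ℂ) * v t + (q t : ℂ) * u t - z * u t‖ := by
        rw [h.eq2 x hxm, hv, zero_add]
        exact intervalIntegral.norm_integral_le_integral_norm hx.1
      have i1 := (h.int1 x hxm).norm
      have i2 := (h.int2 x hxm).norm
      have n3 : (∫ t in a..x, ‖v t - (s t : ℂ) * u t‖) +
          (∫ t in a..x, ‖(s t : ℂ) * v t + (q t : ℂ) * u t - z * u t‖) ≤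
          ∫ t in a..x, κ t * (‖u t‖ + ‖v t‖) := by
        rw [← intervalIntegral.integral_add i1 i2]
        apply intervalIntegral.integral_mono_on hx.1 (i1.add i2)
        · apply IntervalIntegrable.mul_continuousOn
          · exact hκi.mono_set (by
              rw [uIcc_of_le hx.1, uIcc_of_le hX.1.le]
              exact Icc_subset_Icc le_rfl hx.2)
          · rw [uIcc_of_le hx.1]
            exact hcont.mono (Icc_subset_Icc le_rfl hx.2)
        · intro t _
          exact deriv_bound (s t) (q t) z (u t) (v t)
      linarith) X ⟨hX.1.le, le_rfl⟩
  have h1 := norm_nonneg (u X)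
  have h2 := norm_nonneg (v X)
  constructor
  · rw [← norm_le_zero_iff]; linarith
  · rw [← norm_le_zero_iff]; linarith

/-- growing component -/
def Apl (a : ℝ) (N k : ℂ) (u v : ℝ → ℂ) (x : ℝ) : ℂ :=
  N * Complex.exp (-k * ((x : ℂ) - a)) * (u x + v x / k)

/-- decaying component -/
def Bmi (a : ℝ) (N k : ℂ) (u v : ℝ → ℂ) (x : ℝ) : ℂ :=
  N * Complex.exp (-k * ((x : ℂ) - a)) * (u x - v x / k)

section comps

variable {a b : ℝ} {q s : ℝ → ℝ} {u v : ℝ → ℂ} {k : ℂ}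

lemma Apl_eq (h : SolA a b q s (-k ^ 2) u v) (hk : k ≠ 0) (N : ℂ) {X : ℝ} (hX : X ∈ Ico a b) :
    Apl a N k u v X = Apl a N k u v a + ∫ t in a..X, (-((s t : ℂ) * Bmi a N k u v t) +
      (q t : ℂ) / (2 * k) * (Apl a N k u v t + Bmi a N k u v t)) := by
  have i1 := h.int1 X hX
  have i2 := (h.int2 X hX).div_const k
  have hm : ∀ x ∈ Icc a X, x ∈ Ico a b := fun x hx => ⟨hx.1, hx.2.trans_lt hX.2⟩
  have hsub : ∀ x ∈ Icc a X, uIcc a x ⊆ uIcc a X := fun x hx =>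
    uIcc_subset_uIcc left_mem_uIcc (by rw [uIcc_of_le hX.1]; exact hx)
  have P := prod_int (f := fun x => u x + v x / k) hX.1 (i1.add i2) (by
    intro x hx
    rw [intervalIntegral.integral_add (i1.mono_set (hsub x hx)) (i2.mono_set (hsub x hx)),
      intervalIntegral.integral_div]
    have e1 := h.eq1 x (hm x hx)
    have e2 := h.eq2 x (hm x hx)
    linear_combination e1 + e2 / k) N (-k)
  have ha : Apl a N k u v a = N * (u a + v a / k) := by simp [Apl]
  rw [ha]
  unfold Apl at *
  rw [P]
  congr 1
  apply intervalIntegral.integral_congr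
  intro t _
  simp only [Bmi]
  field_simp
  ring

lemma Bmi_eq (h : SolA a b q s (-k ^ 2) u v) (hk : k ≠ 0) (N : ℂ) {X : ℝ} (hX : X ∈ Ico a b) :
    Bmi a N k u v X = Complex.exp (-2 * k * ((X : ℂ) - a)) * Bmi a N k u v a +
      ∫ t in a..X, Complex.exp (-2 * k * ((X : ℂ) - t)) * (-((s t : ℂ) * Apl a N k u v t) -
      (q t : ℂ) / (2 * k) * (Apl a N k u v t + Bmi a N k u v t)) := by
  have i1 := h.int1 X hX
  have i2 := (h.int2 X hX).div_const k
  have hm : ∀ x ∈ Icc a X, x ∈ Ico a b := fun x hx => ⟨hx.1, hx.2.trans_lt hX.2⟩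
  have hsub : ∀ x ∈ Icc a X, uIcc a x ⊆ uIcc a X := fun x hx =>
    uIcc_subset_uIcc left_mem_uIcc (by rw [uIcc_of_le hX.1]; exact hx)
  have P := prod_int (f := fun x => u x - v x / k) hX.1 (i1.sub i2) (by
    intro x hx
    rw [intervalIntegral.integral_sub (i1.mono_set (hsub x hx)) (i2.mono_set (hsub x hx)),
      intervalIntegral.integral_div]
    have e1 := h.eq1 x (hm x hx)
    have e2 := h.eq2 x (hm x hx)
    linear_combination e1 - e2 / k) N k
  have ha : Bmi a N k u v a = N * (u a - v a / k) := by simp [Bmi]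
  rw [ha]
  have hE : Complex.exp (-k * ((X : ℂ) - a)) =
      Complex.exp (-2 * k * ((X : ℂ) - a)) * Complex.exp (k * ((X : ℂ) - a)) := by
    rw [← Complex.exp_add]; congr 1; ring
  have hB : Bmi a N k u v X = Complex.exp (-2 * k * ((X : ℂ) - a)) *
      (N * Complex.exp (k * ((X : ℂ) - a)) * (u X - v X / k)) := by
    rw [Bmi, hE]; ring
  rw [hB, P, mul_add, ← intervalIntegral.integral_const_mul]
  congr 1
  apply intervalIntegral.integral_congr
  intro t _
  have hE2 : Complex.exp (-2 * k * ((X : ℂ) - a)) * Complex.exp (k * ((t : ℂ) - a)) =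
      Complex.exp (-2 * k * ((X : ℂ) - t)) * Complex.exp (-k * ((t : ℂ) - a)) := by
    rw [← Complex.exp_add, ← Complex.exp_add]; congr 1; ring
  simp only [Apl, Bmi]
  have e3 : k * (u t - v t / k) + (v t - (s t : ℂ) * u t -
      ((s t : ℂ) * v t + (q t : ℂ) * u t - -k ^ 2 * u t) / k) =
      -((s t : ℂ) * (u t + v t / k)) - (q t : ℂ) / (2 * k) * (2 * u t) := by
    field_simp
    ring
  rw [e3]
  linear_combination (N * (-((s t : ℂ) * (u t + v t / k)) - (q t : ℂ) / (2 * k) * (2 * u t))) * hE2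

lemma Apl_cont (h : SolA a b q s (-k ^ 2) u v) (N : ℂ) {X : ℝ} (hX : X ∈ Ico a b) :
    ContinuousOn (Apl a N k u v) (Icc a X) := by
  obtain ⟨c1, c2⟩ := h.cont hX
  unfold Apl
  refine ContinuousOn.mul (Continuous.continuousOn (by fun_prop)) (c1.add (c2.div_const k))

lemma Bmi_cont (h : SolA a b q s (-k ^ 2) u v) (N : ℂ) {X : ℝ} (hX : X ∈ Ico a b) :
    ContinuousOn (Bmi a N k u v) (Icc a X) := by
  obtain ⟨c1, c2⟩ := h.cont hX
  unfold Bmi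
  refine ContinuousOn.mul (Continuous.continuousOn (by fun_prop)) (c1.sub (c2.div_const k))

lemma coef_bound (sx qx : ℝ) (hk : 1 ≤ ‖k‖) (A B : ℂ) :
    ‖-((sx : ℂ) * B) + (qx : ℂ) / (2 * k) * (A + B)‖ ≤ |sx| * ‖B‖ + |qx| / 2 * (‖A‖ + ‖B‖) ∧
    ‖-((sx : ℂ) * A) - (qx : ℂ) / (2 * k) * (A + B)‖ ≤ |sx| * ‖A‖ + |qx| / 2 * (‖A‖ + ‖B‖) := by
  have h1 : ‖(qx : ℂ) / (2 * k) * (A + B)‖ ≤ |qx| / 2 * (‖A‖ + ‖B‖) := by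
    rw [norm_mul, norm_div, norm_mul, Complex.norm_real, Real.norm_eq_abs]
    refine mul_le_mul ?_ (norm_add_le _ _) (norm_nonneg _) (by positivity)
    simp only [Complex.norm_ofNat]
    apply div_le_div_of_nonneg_left (abs_nonneg _) (by norm_num)
    linarith
  constructor
  · refine (norm_add_le _ _).trans ?_
    have : ‖-((sx : ℂ) * B)‖ = |sx| * ‖B‖ := by simp
    linarith
  · refine (norm_sub_le _ _).trans ?_
    have : ‖-((sx : ℂ) * A)‖ = |sx| * ‖A‖ := by simp
    linarith

lemma norm_exp_le_one (hk : 0 ≤ k.re) {x t : ℝ} (h : t ≤ x) :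
    ‖Complex.exp (-2 * k * ((x : ℂ) - t))‖ = Real.exp (-2 * k.re * (x - t)) ∧
    ‖Complex.exp (-2 * k * ((x : ℂ) - t))‖ ≤ 1 := by
  have e : ‖Complex.exp (-2 * k * ((x : ℂ) - t))‖ = Real.exp (-2 * k.re * (x - t)) := by
    rw [Complex.norm_exp]
    congr 1
    simp
  refine ⟨e, ?_⟩
  rw [e, Real.exp_le_one_iff]
  nlinarith [mul_nonneg hk (sub_nonneg.mpr h)]

lemma bound_AB (hq : ∀ x ∈ Set.Ioo a b, IntervalIntegrable q volume a x)
    (hs : ∀ x ∈ Set.Ioo a b, IntervalIntegrable s volume a x) {X : ℝ} (hX : X ∈ Ioo a b) :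
    ∃ M : ℝ, 0 < M ∧ ∀ (k N : ℂ) (u v : ℝ → ℂ), SolA a b q s (-k ^ 2) u v → 1 ≤ ‖k‖ → 0 ≤ k.re →
      ∀ x ∈ Icc a X, ‖Apl a N k u v x‖ + ‖Bmi a N k u v x‖ ≤
        M * (‖Apl a N k u v a‖ + ‖Bmi a N k u v a‖) := by
  set κ : ℝ → ℝ := fun t => |s t| + |q t| with hκ
  have hκ0 : ∀ t, 0 ≤ κ t := fun t => by positivity
  have hκi : IntervalIntegrable κ volume a X := (hs X hX).abs.add (hq X hX).abs
  obtain ⟨M, hM, H⟩ := gronwall_fwd hX.1.le hκ0 hκi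
  refine ⟨M, hM, ?_⟩
  intro k N u v h hk hre
  have hk0 : k ≠ 0 := by
    rintro rfl
    simp at hk
    linarith
  have hX' : X ∈ Ico a b := ⟨hX.1.le, hX.2⟩
  set A := Apl a N k u v with hA
  set B := Bmi a N k u v with hB
  have cA : ContinuousOn A (Icc a X) := Apl_cont h N hX'
  have cB : ContinuousOn B (Icc a X) := Bmi_cont h N hX'
  have hcont : ContinuousOn (fun x => ‖A x‖ + ‖B x‖) (Icc a X) := cA.norm.add cB.norm
  refine H (fun x => ‖A x‖ + ‖B x‖) (‖A a‖ + ‖B a‖) X (by positivity) ⟨hX.1.le, le_rfl⟩ hcont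
    (fun x _ => by positivity) ?_
  intro x hx
  have hxm : x ∈ Ico a b := ⟨hx.1, hx.2.trans_lt hX.2⟩
  have hsx : uIcc a x ⊆ uIcc a X := by
    rw [uIcc_of_le hx.1, uIcc_of_le hX.1.le]
    exact Icc_subset_Icc le_rfl hx.2
  have is := (hs X hX).abs.mono_set hsx
  have iq := (hq X hX).abs.mono_set hsx
  have hIx : uIcc a x ⊆ Icc a X := by rwa [uIcc_of_le hX.1.le] at hsx
  have j1 : IntervalIntegrable (fun t => |s t| * ‖B t‖ + |q t| / 2 * (‖A t‖ + ‖B t‖))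
      volume a x :=
    (is.mul_continuousOn (cB.norm.mono hIx)).add
      ((iq.div_const 2).mul_continuousOn (hcont.mono hIx))
  have j2 : IntervalIntegrable (fun t => |s t| * ‖A t‖ + |q t| / 2 * (‖A t‖ + ‖B t‖))
      volume a x :=
    (is.mul_continuousOn (cA.norm.mono hIx)).add
      ((iq.div_const 2).mul_continuousOn (hcont.mono hIx))
  have n1 : ‖A x‖ ≤ ‖A a‖ + ∫ t in a..x, (|s t| * ‖B t‖ + |q t| / 2 * (‖A t‖ + ‖B t‖)) := by
    rw [hA, Apl_eq h hk0 N hxm]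
    refine (norm_add_le _ _).trans ?_
    gcongr
    exact intervalIntegral.norm_integral_le_of_norm_le hx.1
      (Eventually.of_forall fun t _ => (coef_bound (s t) (q t) hk _ _).1) j1
  have n2 : ‖B x‖ ≤ ‖B a‖ + ∫ t in a..x, (|s t| * ‖A t‖ + |q t| / 2 * (‖A t‖ + ‖B t‖)) := by
    rw [hB, Bmi_eq h hk0 N hxm]
    refine (norm_add_le _ _).trans ?_
    apply add_le_add
    · rw [norm_mul]
      exact mul_le_of_le_one_left (norm_nonneg _) (norm_exp_le_one hre hx.1).2
    exact intervalIntegral.norm_integral_le_of_norm_le hx.1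
      (Eventually.of_forall fun t ht => by
        rw [norm_mul]
        refine (mul_le_of_le_one_left (norm_nonneg _) (norm_exp_le_one hre ht.2).2).trans ?_
        exact (coef_bound (s t) (q t) hk _ _).2) j2
  have n3 : (∫ t in a..x, (|s t| * ‖B t‖ + |q t| / 2 * (‖A t‖ + ‖B t‖))) +
      (∫ t in a..x, (|s t| * ‖A t‖ + |q t| / 2 * (‖A t‖ + ‖B t‖))) =
      ∫ t in a..x, κ t * (‖A t‖ + ‖B t‖) := by
    rw [← intervalIntegral.integral_add j1 j2]
    congr 1
    ext t
    simp only [hκ]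
    ring
  linarith

end comps

lemma tendsto_rexp_aux {r : ℝ → ℝ} (hr : Tendsto r atTop atTop) {d : ℝ} (hd : 0 < d) :
    Tendsto (fun t => Real.exp (-2 * r t * d)) atTop (𝓝 0) := by
  apply Real.tendsto_exp_atBot.comp
  have : Tendsto (fun t => (-2 * d) * r t) atTop atBot :=
    hr.const_mul_atTop_of_neg (by linarith)
  refine this.congr fun t => by ring

lemma lim_AB {a b : ℝ} {q s : ℝ → ℝ}
    (hq : ∀ x ∈ Set.Ioo a b, IntervalIntegrable q volume a x)
    (hs : ∀ x ∈ Set.Ioo a b, IntervalIntegrable s volume a x)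
    (k N : ℝ → ℂ) (u v : ℝ → ℝ → ℂ)
    (h : ∀ t, SolA a b q s (-(k t) ^ 2) (u t) (v t))
    (hk : Tendsto (fun t => (k t).re) atTop atTop)
    (hA : Tendsto (fun t => Apl a (N t) (k t) (u t) (v t) a) atTop (𝓝 1))
    (hB : ∀ᶠ t in atTop, ‖Bmi a (N t) (k t) (u t) (v t) a‖ ≤ 2)
    {X : ℝ} (hX : X ∈ Ioo a b) :
    Tendsto (fun t => Apl a (N t) (k t) (u t) (v t) X + Bmi a (N t) (k t) (u t) (v t) X)
      atTop (𝓝 1) := by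
  obtain ⟨M, hM, H⟩ := bound_AB hq hs hX
  set A : ℝ → ℝ → ℂ := fun t => Apl a (N t) (k t) (u t) (v t) with hAdef
  set B : ℝ → ℝ → ℂ := fun t => Bmi a (N t) (k t) (u t) (v t) with hBdef
  have hre : ∀ᶠ t in atTop, 1 ≤ (k t).re := hk.eventually_ge_atTop 1
  have hA2 : ∀ᶠ t in atTop, ‖A t a‖ ≤ 2 := by
    have := hA.norm
    rw [norm_one] at this
    exact (this.eventually (gt_mem_nhds (by norm_num : (1 : ℝ) < 2))).mono fun t ht => le_of_lt ht
  set D := M * 4 with hD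
  have hD0 : 0 ≤ D := by positivity
  have hgood : ∀ᶠ t in atTop, 0 ≤ (k t).re ∧ 1 ≤ ‖k t‖ ∧ k t ≠ 0 ∧ ‖B t a‖ ≤ 2 ∧
      ∀ x ∈ Icc a X, ‖A t x‖ + ‖B t x‖ ≤ D := by
    filter_upwards [hre, hA2, hB] with t h1 h2 h3
    have h4 : 1 ≤ ‖k t‖ := h1.trans ((le_abs_self _).trans (Complex.abs_re_le_norm _))
    refine ⟨by linarith, h4, ?_, h3, fun x hx => ?_⟩
    · intro h0
      rw [h0] at h4
      simp at h4
      linarith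
    · refine (H (k t) (N t) (u t) (v t) (h t) h4 (by linarith) x hx).trans ?_
      rw [hD]
      apply mul_le_mul_of_nonneg_left _ hM.le
      change ‖A t a‖ + ‖B t a‖ ≤ 4
      have : ‖B t a‖ ≤ 2 := h3
      linarith
  set κ : ℝ → ℝ := fun t => |s t| + |q t| with hκ
  have hκ0 : ∀ t, 0 ≤ κ t := fun t => by positivity
  have hκi : IntervalIntegrable κ volume a X := (hs X hX).abs.add (hq X hX).abs
  have hB0 : ∀ x ∈ Ioc a X, Tendsto (fun t => B t x) atTop (𝓝 0) := by
    intro x hx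
    have hxm : x ∈ Ico a b := ⟨hx.1.le, hx.2.trans_lt hX.2⟩
    have hsx : uIcc a x ⊆ uIcc a X := by
      rw [uIcc_of_le hx.1.le, uIcc_of_le hX.1.le]
      exact Icc_subset_Icc le_rfl hx.2
    have hκx : IntervalIntegrable κ volume a x := hκi.mono_set hsx
    have hJ : ∀ t, IntervalIntegrable
        (fun y => Real.exp (-2 * (k t).re * (x - y)) * (κ y * D)) volume a x := fun t =>
      (hκx.mul_const D).continuousOn_mul (Continuous.continuousOn (by fun_prop))
    rw [tendsto_zero_iff_norm_tendsto_zero]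
    have hlim1 : Tendsto (fun t => Real.exp (-2 * (k t).re * (x - a)) * 2) atTop (𝓝 0) := by
      simpa using (tendsto_rexp_aux hk (sub_pos.mpr hx.1)).mul_const 2
    have hlim2 : Tendsto (fun t => ∫ y in a..x, Real.exp (-2 * (k t).re * (x - y)) * (κ y * D))
        atTop (𝓝 0) := by
      have := intervalIntegral.tendsto_integral_filter_of_dominated_convergence
        (μ := volume) (a := a) (b := x) (l := atTop) (f := fun _ => (0 : ℝ))
        (F := fun t y => Real.exp (-2 * (k t).re * (x - y)) * (κ y * D))
        (fun y => κ y * D)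
        (Eventually.of_forall fun t => by
          have := (hJ t).1.aestronglyMeasurable
          rwa [uIoc_of_le hx.1.le])
        (by
          filter_upwards [hgood] with t ht
          refine Eventually.of_forall fun y hy => ?_
          rw [uIoc_of_le hx.1.le] at hy
          have h0 : 0 ≤ κ y * D := mul_nonneg (hκ0 y) hD0
          rw [norm_mul, Real.norm_eq_abs, Real.norm_eq_abs, abs_of_nonneg h0, Real.abs_exp]
          apply mul_le_of_le_one_left h0
          rw [Real.exp_le_one_iff]
          nlinarith [mul_nonneg ht.1 (sub_nonneg.mpr hy.2)])
        (hκx.mul_const D)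
        (by
          filter_upwards [Measure.ae_ne volume x] with y hyx hy
          rw [uIoc_of_le hx.1.le] at hy
          have hlt : y < x := lt_of_le_of_ne hy.2 hyx
          simpa using (tendsto_rexp_aux hk (sub_pos.mpr hlt)).mul_const (κ y * D))
      simpa using this
    have hlim := hlim1.add hlim2
    rw [add_zero] at hlim
    refine squeeze_zero' (Eventually.of_forall fun t => norm_nonneg _) ?_ hlim
    filter_upwards [hgood] with t ⟨g1, g2, g3, g4, g5⟩
    change ‖Bmi a (N t) (k t) (u t) (v t) x‖ ≤ _
    rw [Bmi_eq (h t) g3 (N t) hxm]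
    refine (norm_add_le _ _).trans ?_
    apply add_le_add
    · rw [norm_mul, (norm_exp_le_one g1 hx.1.le).1]
      exact mul_le_mul_of_nonneg_left g4 (Real.exp_nonneg _)
    · refine intervalIntegral.norm_integral_le_of_norm_le hx.1.le
        (Eventually.of_forall fun y hy => ?_) (hJ t)
      rw [norm_mul, (norm_exp_le_one g1 hy.2).1]
      apply mul_le_mul_of_nonneg_left _ (Real.exp_nonneg _)
      refine (coef_bound (s y) (q y) g2 _ _).2.trans ?_
      have g6 := g5 y ⟨hy.1.le, hy.2.trans hx.2⟩
      change |s y| * ‖A t y‖ + |q y| / 2 * (‖A t y‖ + ‖B t y‖) ≤ (|s y| + |q y|) * D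
      have t1 : |s y| * ‖A t y‖ ≤ |s y| * D :=
        mul_le_mul_of_nonneg_left (by linarith [norm_nonneg (B t y)]) (abs_nonneg _)
      have t2 : |q y| / 2 * (‖A t y‖ + ‖B t y‖) ≤ |q y| / 2 * D :=
        mul_le_mul_of_nonneg_left g6 (by positivity)
      have t3 : 0 ≤ |q y| * D := by positivity
      linarith
  have hX' : X ∈ Ico a b := ⟨hX.1.le, hX.2⟩
  have hkinv : Tendsto (fun t => ‖k t‖⁻¹) atTop (𝓝 0) := by
    apply tendsto_inv_atTop_zero.comp
    exact tendsto_atTop_mono (fun t => (le_abs_self _).trans (Complex.abs_re_le_norm _)) hk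
  have hI : Tendsto (fun t => ∫ y in a..X, (-((s y : ℂ) * B t y) +
      (q y : ℂ) / (2 * k t) * (A t y + B t y))) atTop (𝓝 0) := by
    have := intervalIntegral.tendsto_integral_filter_of_dominated_convergence
      (μ := volume) (a := a) (b := X) (l := atTop) (f := fun _ => (0 : ℂ))
      (F := fun t y => (-((s y : ℂ) * B t y) + (q y : ℂ) / (2 * k t) * (A t y + B t y)))
      (fun y => κ y * D)
      (Eventually.of_forall fun t => by
        have cA : ContinuousOn (A t) (Icc a X) := Apl_cont (h t) (N t) hX'
        have cB : ContinuousOn (B t) (Icc a X) := Bmi_cont (h t) (N t) hX'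
        have mA : AEStronglyMeasurable (A t) (volume.restrict (Ioc a X)) :=
          (cA.mono Ioc_subset_Icc_self).aestronglyMeasurable measurableSet_Ioc
        have mB : AEStronglyMeasurable (B t) (volume.restrict (Ioc a X)) :=
          (cB.mono Ioc_subset_Icc_self).aestronglyMeasurable measurableSet_Ioc
        have msC : AEStronglyMeasurable (fun t => (s t : ℂ)) (volume.restrict (Ioc a X)) :=
          Complex.continuous_ofReal.comp_aestronglyMeasurable (hs X hX).1.aestronglyMeasurable
        have mqC : AEStronglyMeasurable (fun t => (q t : ℂ)) (volume.restrict (Ioc a X)) :=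
          Complex.continuous_ofReal.comp_aestronglyMeasurable (hq X hX).1.aestronglyMeasurable
        rw [uIoc_of_le hX.1.le]
        simp only [div_eq_mul_inv]
        exact (msC.mul mB).neg.add ((mqC.mul_const _).mul (mA.add mB)))
      (by
        filter_upwards [hgood] with t ⟨g1, g2, g3, g4, g5⟩
        refine Eventually.of_forall fun y hy => ?_
        rw [uIoc_of_le hX.1.le] at hy
        refine (coef_bound (s y) (q y) g2 _ _).1.trans ?_
        have g6 := g5 y ⟨hy.1.le, hy.2⟩
        change |s y| * ‖B t y‖ + |q y| / 2 * (‖A t y‖ + ‖B t y‖) ≤ (|s y| + |q y|) * D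
        have t1 : |s y| * ‖B t y‖ ≤ |s y| * D :=
          mul_le_mul_of_nonneg_left (by linarith [norm_nonneg (A t y)]) (abs_nonneg _)
        have t2 : |q y| / 2 * (‖A t y‖ + ‖B t y‖) ≤ |q y| / 2 * D :=
          mul_le_mul_of_nonneg_left g6 (by positivity)
        have t3 : 0 ≤ |q y| * D := by positivity
        linarith)
      (hκi.mul_const D)
      (by
        refine Eventually.of_forall fun y hy => ?_
        rw [uIoc_of_le hX.1.le] at hy
        have l1 : Tendsto (fun t => -((s y : ℂ) * B t y)) atTop (𝓝 0) := by
          simpa using ((hB0 y hy).const_mul (s y : ℂ)).neg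
        have l2 : Tendsto (fun t => (q y : ℂ) / (2 * k t) * (A t y + B t y)) atTop (𝓝 0) := by
          have l3 : Tendsto (fun t => |q y| * D / 2 * ‖k t‖⁻¹) atTop (𝓝 0) := by
            simpa using hkinv.const_mul (|q y| * D / 2)
          refine squeeze_zero_norm' ?_ l3
          filter_upwards [hgood] with t ⟨g1, g2, g3, g4, g5⟩
          have g6 := g5 y ⟨hy.1.le, hy.2⟩
          rw [norm_mul, norm_div, norm_mul, Complex.norm_real, Real.norm_eq_abs,
            Complex.norm_ofNat]
          calc |q y| / (2 * ‖k t‖) * ‖A t y + B t y‖ ≤ |q y| / (2 * ‖k t‖) * D := by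
                gcongr
                exact (norm_add_le _ _).trans g6
            _ = |q y| * D / 2 * ‖k t‖⁻¹ := by
                field_simp
        simpa using l1.add l2)
    simpa using this
  have hAX : Tendsto (fun t => A t X) atTop (𝓝 1) := by
    have := hA.add hI
    rw [add_zero] at this
    refine this.congr' ?_
    filter_upwards [hgood] with t ⟨g1, g2, g3, g4, g5⟩
    exact (Apl_eq (h t) g3 (N t) hX').symm
  simpa using hAX.add (hB0 X ⟨hX.1, le_rfl⟩)

lemma msqrt_sq (z : ℂ) : -(msqrt z) ^ 2 = z := by
  unfold msqrt
  rw [← Complex.cpow_nat_mul]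
  norm_num

lemma msqrt_ray {w : ℂ} (hw : w.im ≠ 0) :
    Tendsto (fun t : ℝ => (msqrt ((t : ℂ) * w)).re) atTop atTop := by
  have hw0 : -w ≠ 0 := by
    intro h0
    apply hw
    have : w = 0 := by simpa using h0
    simp [this]
  have hpos : 0 < (msqrt w).re := by
    unfold msqrt
    rw [Complex.cpow_def_of_ne_zero hw0, Complex.exp_re]
    apply mul_pos (Real.exp_pos _)
    have him : (Complex.log (-w) * (1 / 2)).im = Complex.arg (-w) / 2 := by
      rw [show (1 / 2 : ℂ) = ((1 / 2 : ℝ) : ℂ) by norm_num, Complex.im_mul_ofReal, Complex.log_im]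
      ring
    rw [him]
    apply Real.cos_pos_of_mem_Ioo
    have h1 := Complex.neg_pi_lt_arg (-w)
    have h2 : Complex.arg (-w) < Real.pi := by
      refine lt_of_le_of_ne (Complex.arg_le_pi _) ?_
      intro h3
      rw [Complex.arg_eq_pi_iff] at h3
      apply hw
      simpa using h3.2
    constructor <;> linarith
  have hform : ∀ᶠ t : ℝ in atTop, Real.sqrt t * (msqrt w).re = (msqrt ((t : ℂ) * w)).re := by
    filter_upwards [eventually_gt_atTop 0] with t ht
    unfold msqrt
    have ht0 : (t : ℂ) * -w ≠ 0 := mul_ne_zero (by exact_mod_cast ht.ne') hw0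
    rw [← mul_neg, Complex.cpow_def_of_ne_zero ht0, Complex.cpow_def_of_ne_zero hw0,
      Complex.log_ofReal_mul ht hw0, add_mul, Complex.exp_add]
    have : Complex.exp ((Real.log t : ℂ) * (1 / 2)) = ((Real.sqrt t : ℝ) : ℂ) := by
      rw [Real.sqrt_eq_rpow, Real.rpow_def_of_pos ht]
      push_cast
      rfl
    rw [this, Complex.re_ofReal_mul]
  refine Tendsto.congr' hform ?_
  exact Real.tendsto_sqrt_atTop.atTop_mul_const hpos

/-- For a real entire solution `φ_z` lying in `dom S` near the regular endpoint `a`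
(case `p = r = 1`): `φ_z(x) = φ_z(x₀) e^{(x-x₀)√(-z)} (1+o(1))` as `|z| → ∞`
along any nonreal ray. -/
theorem phi_ratio_asymptotics {a b : ℝ} {q s : ℝ → ℝ}
    (hyp : SLHyp a b (fun _ => 1) q (fun _ => 1) s)
    (hq : ∀ x ∈ Set.Ioo a b, IntervalIntegrable q volume a x)
    (hs : ∀ x ∈ Set.Ioo a b, IntervalIntegrable s volume a x)
    {φ φq : ℂ → ℝ → ℂ} (hφ : RealEntireSolFamSchr a b q s φ φq)
    {x₀ x : ℝ} (hx₀ : x₀ ∈ Set.Ioo a b) (hx : x ∈ Set.Ioo a b)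
    {w : ℂ} (hw : w.im ≠ 0) :
    Tendsto (fun t : ℝ => φ ((t : ℂ) * w) x /
        (φ ((t : ℂ) * w) x₀ * Complex.exp (((x : ℂ) - (x₀ : ℂ)) * msqrt ((t : ℂ) * w))))
      atTop (𝓝 1) := by
  choose u v huv hsol using fun z => exists_ext hyp.lt hyp.ms hyp.mq hq hs (hφ.sol z)
  have hlimu : ∀ z, Tendsto (u z) (𝓝[>] a) (𝓝 (u z a)) ∧
      Tendsto (v z) (𝓝[>] a) (𝓝 (v z a)) := by
    intro z
    obtain ⟨c1, c2⟩ := (hsol z).cont (X := x) ⟨hx.1.le, hx.2⟩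
    have hle : 𝓝[>] a ≤ 𝓝[Icc a x] a := by
      rw [← nhdsWithin_Ioc_eq_nhdsGT hx.1]
      exact nhdsWithin_mono _ Ioc_subset_Icc_self
    exact ⟨(c1 a ⟨le_rfl, hx.1.le⟩).mono_left hle, (c2 a ⟨le_rfl, hx.1.le⟩).mono_left hle⟩
  have hW : ∀ z ζ, u z a * v ζ a - v z a * u ζ a = 0 := by
    intro z ζ
    have h1 := ((hlimu z).1.mul (hlimu ζ).2).sub ((hlimu z).2.mul (hlimu ζ).1)
    refine tendsto_nhds_unique (h1.congr' ?_) (hφ.bc z ζ)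
    filter_upwards [Ioo_mem_nhdsGT hyp.lt] with y hy
    simp only [Wr, (huv z y hy).1, (huv z y hy).2, (huv ζ y hy).1, (huv ζ y hy).2]
  have hne : ∀ z, ¬ (u z a = 0 ∧ v z a = 0) := by
    rintro z ⟨h1, h2⟩
    obtain ⟨y, hy, h3⟩ := hφ.nontriv z
    obtain ⟨h4, h5⟩ := (hsol z).zero hq hs h1 h2 hy
    rw [(huv z y hy).1] at h4
    rw [(huv z y hy).2] at h5
    rcases h3 with h3 | h3
    · exact h3 h4
    · exact h3 h5
  set k : ℝ → ℂ := fun t => msqrt ((t : ℂ) * w) with hkdef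
  have hk : Tendsto (fun t => (k t).re) atTop atTop := msqrt_ray hw
  have hk0 : ∀ᶠ t in atTop, k t ≠ 0 := by
    filter_upwards [hk.eventually_gt_atTop 0] with t ht h0
    rw [h0] at ht
    simp at ht
  have hkinv : Tendsto (fun t => (k t)⁻¹) atTop (𝓝 0) := by
    rw [tendsto_zero_iff_norm_tendsto_zero]
    simp only [norm_inv]
    apply tendsto_inv_atTop_zero.comp
    exact tendsto_atTop_mono (fun t => (le_abs_self _).trans (Complex.abs_re_le_norm _)) hk
  set U : ℝ → ℝ → ℂ := fun t => u ((t : ℂ) * w) with hU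
  set V : ℝ → ℝ → ℂ := fun t => v ((t : ℂ) * w) with hV
  have hS : ∀ t, SolA a b q s (-(k t) ^ 2) (U t) (V t) := by
    intro t
    have := hsol ((t : ℂ) * w)
    rw [← msqrt_sq ((t : ℂ) * w)] at this
    simpa [hkdef, hU, hV, msqrt_sq] using this
  have hWt : ∀ t, U t a * v 0 a = V t a * u 0 a := fun t => by
    have := hW ((t : ℂ) * w) 0
    exact sub_eq_zero.mp this
  have hnet : ∀ t, ¬ (U t a = 0 ∧ V t a = 0) := fun t => hne _
  obtain ⟨N, hN0, hNA, hNB⟩ : ∃ N : ℝ → ℂ, (∀ᶠ t in atTop, N t ≠ 0) ∧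
      Tendsto (fun t => Apl a (N t) (k t) (U t) (V t) a) atTop (𝓝 1) ∧
      ∀ᶠ t in atTop, ‖Bmi a (N t) (k t) (U t) (V t) a‖ ≤ 2 := by
    by_cases he : u 0 a = 0
    · have hf : v 0 a ≠ 0 := fun h => hne 0 ⟨he, h⟩
      have hU0 : ∀ t, U t a = 0 := fun t => by
        have := hWt t
        rw [he, mul_zero] at this
        exact (mul_eq_zero.mp this).resolve_right hf
      have hV0 : ∀ t, V t a ≠ 0 := fun t h => hnet t ⟨hU0 t, h⟩
      refine ⟨fun t => k t / V t a, ?_, ?_, ?_⟩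
      · filter_upwards [hk0] with t ht
        exact div_ne_zero ht (hV0 t)
      · refine tendsto_const_nhds.congr' ?_
        filter_upwards [hk0] with t ht
        have := hV0 t
        simp only [Apl, hU0 t, sub_self, mul_zero, Complex.exp_zero]
        field_simp
        ring
      · filter_upwards [hk0] with t ht
        have := hV0 t
        have e : Bmi a (k t / V t a) (k t) (U t) (V t) a = -1 := by
          simp only [Bmi, hU0 t, sub_self, mul_zero, Complex.exp_zero]
          field_simp
          ring
        rw [e]
        norm_num
    · have hU0 : ∀ t, U t a ≠ 0 := fun t h => by
        refine hnet t ⟨h, ?_⟩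
        have := hWt t
        rw [h, zero_mul] at this
        exact (mul_eq_zero.mp this.symm).resolve_right he
      have hVU : ∀ t, V t a = U t a * (v 0 a / u 0 a) := fun t => by
        have := hWt t
        field_simp
        exact this.symm
      have hl := hkinv.const_mul (v 0 a / u 0 a)
      rw [mul_zero] at hl
      refine ⟨fun t => (U t a)⁻¹, Eventually.of_forall fun t => inv_ne_zero (hU0 t), ?_, ?_⟩
      · have h1 := hl.const_add 1
        rw [add_zero] at h1
        refine h1.congr fun t => ?_
        have := hU0 t
        simp only [Apl, hVU t, sub_self, mul_zero, Complex.exp_zero]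
        rw [mul_one, mul_add, inv_mul_cancel₀ this, div_eq_mul_inv _ (k t), mul_assoc (U t a),
          inv_mul_cancel_left₀ this]
      · have h1 := hl.const_sub 1
        rw [sub_zero] at h1
        have h2 := h1.norm
        rw [norm_one] at h2
        filter_upwards [h2.eventually (gt_mem_nhds (by norm_num : (1 : ℝ) < 2))] with t ht
        have := hU0 t
        have e : Bmi a (U t a)⁻¹ (k t) (U t) (V t) a = 1 - v 0 a / u 0 a * (k t)⁻¹ := by
          simp only [Bmi, hVU t, sub_self, mul_zero, Complex.exp_zero]
          rw [mul_one, mul_sub, inv_mul_cancel₀ this, div_eq_mul_inv _ (k t), mul_assoc (U t a),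
            inv_mul_cancel_left₀ this]
        rw [e]
        exact le_of_lt ht
  have L1 := lim_AB hq hs k N U V hS hk hNA hNB hx
  have L0 := lim_AB hq hs k N U V hS hk hNA hNB hx₀
  have L := L1.div L0 one_ne_zero
  rw [div_one] at L
  refine L.congr' ?_
  filter_upwards [hN0] with t ht
  have hsum : ∀ y ∈ Ioo a b, Apl a (N t) (k t) (U t) (V t) y + Bmi a (N t) (k t) (U t) (V t) y =
      2 * N t * Complex.exp (-(k t) * ((y : ℂ) - a)) * φ ((t : ℂ) * w) y := by
    intro y hy
    rw [← (huv ((t : ℂ) * w) y hy).1]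
    simp only [Apl, Bmi, hU]
    ring
  simp only [Pi.div_apply]
  rw [hsum x hx, hsum x₀ hx₀]
  have hE : Complex.exp (-(k t) * ((x₀ : ℂ) - a)) =
      Complex.exp (-(k t) * ((x : ℂ) - a)) * Complex.exp (((x : ℂ) - x₀) * k t) := by
    rw [← Complex.exp_add]
    congr 1
    ring
  rw [hE]
  have hc : 2 * N t * Complex.exp (-(k t) * ((x : ℂ) - a)) ≠ 0 :=
    mul_ne_zero (mul_ne_zero two_ne_zero ht) (Complex.exp_ne_zero _)
  rw [← mul_div_mul_left (φ ((t : ℂ) * w) x) _ hc]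
  congr 1
  ring
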